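/- arXiv:2006.02417 — 5 statements merged into one kernel-verified Lean document; each statement's English description precedes it below -/
import Mathlib

section
/- If Γ ⊢ A is derivable in the natural deduction system IEL⁻, then Γ ⊢_𝔽 A is derivable in the Hilbert-style system 𝔽IEL⁻. -/
/-- Formulas of intuitionistic epistemic logic. -/
inductive Formula : Type
  | atom : ℕ → Formula
  | bot : Formula
  | top : Formula
  | and : Formula → Formula → Formula
  | or : Formula → Formula → Formula
  | impl : Formula → Formula → Formula
  | box : Formula → Formula
  deriving DecidableEq

namespace Formula

/-- Negation is defined: ¬A := A → ⊥. -/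
def neg (A : Formula) : Formula := A.impl .bot

end Formula

/-- The Hilbert-style system 𝔽IEL⁻: axiom schemes of intuitionistic
propositional logic, the K-scheme, the co-reflection scheme, and modus ponens. -/
inductive Hilbert : Set Formula → Formula → Prop
  | hyp {Γ : Set Formula} {A : Formula} : A ∈ Γ → Hilbert Γ A
  | ax1 {Γ : Set Formula} (A B : Formula) : Hilbert Γ (A.impl (B.impl A))
  | ax2 {Γ : Set Formula} (A B C : Formula) :
      Hilbert Γ ((A.impl (B.impl C)).impl ((A.impl B).impl (A.impl C)))
  | ax_and_intro {Γ : Set Formula} (A B : Formula) : Hilbert Γ (A.impl (B.impl (A.and B)))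
  | ax_and_left {Γ : Set Formula} (A B : Formula) : Hilbert Γ ((A.and B).impl A)
  | ax_and_right {Γ : Set Formula} (A B : Formula) : Hilbert Γ ((A.and B).impl B)
  | ax_or_inl {Γ : Set Formula} (A B : Formula) : Hilbert Γ (A.impl (A.or B))
  | ax_or_inr {Γ : Set Formula} (A B : Formula) : Hilbert Γ (B.impl (A.or B))
  | ax_or_elim {Γ : Set Formula} (A B C : Formula) :
      Hilbert Γ ((A.impl C).impl ((B.impl C).impl ((A.or B).impl C)))
  | ax_bot {Γ : Set Formula} (A : Formula) : Hilbert Γ (Formula.bot.impl A)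
  | ax_top {Γ : Set Formula} : Hilbert Γ Formula.top
  | ax_K {Γ : Set Formula} (A B : Formula) :
      Hilbert Γ ((Formula.box (A.impl B)).impl ((Formula.box A).impl (Formula.box B)))
  | ax_coreflection {Γ : Set Formula} (A : Formula) : Hilbert Γ (A.impl (Formula.box A))
  | mp {Γ : Set Formula} {A B : Formula} : Hilbert Γ (A.impl B) → Hilbert Γ A → Hilbert Γ B

/-- The natural deduction system IEL⁻: the propositional fragment of NJ
extended by the □-introduction rule. -/
inductive ND : Set Formula → Formula → Prop
  | hyp {Γ : Set Formula} {A : Formula} : A ∈ Γ → ND Γ A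
  | top_intro {Γ : Set Formula} : ND Γ Formula.top
  | bot_elim {Γ : Set Formula} {A : Formula} : ND Γ Formula.bot → ND Γ A
  | and_intro {Γ : Set Formula} {A B : Formula} : ND Γ A → ND Γ B → ND Γ (A.and B)
  | and_elim_left {Γ : Set Formula} {A B : Formula} : ND Γ (A.and B) → ND Γ A
  | and_elim_right {Γ : Set Formula} {A B : Formula} : ND Γ (A.and B) → ND Γ B
  | impl_intro {Γ : Set Formula} {A B : Formula} : ND (insert A Γ) B → ND Γ (A.impl B)
  | impl_elim {Γ : Set Formula} {A B : Formula} : ND Γ (A.impl B) → ND Γ A → ND Γ B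
  | or_intro_left {Γ : Set Formula} {A B : Formula} : ND Γ A → ND Γ (A.or B)
  | or_intro_right {Γ : Set Formula} {A B : Formula} : ND Γ B → ND Γ (A.or B)
  | or_elim {Γ : Set Formula} {A B C : Formula} :
      ND Γ (A.or B) → ND (insert A Γ) C → ND (insert B Γ) C → ND Γ C
  | box_intro {ps : List (Set Formula × Formula)} {Δ : Set Formula} {B : Formula} :
      (∀ p ∈ ps, ND p.1 (Formula.box p.2)) →
      ND ({A | ∃ p ∈ ps, p.2 = A} ∪ Δ) B →
      ND ((⋃ p ∈ ps, p.1) ∪ Δ) (Formula.box B)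


namespace Hilbert

/-- Induction on Hilbert derivations, treating all axioms uniformly as formulas derivable from
every context. -/
theorem axiomatic_induction {Δ : Set Formula} {P : Formula → Prop}
    (mem : ∀ A ∈ Δ, P A) (valid : ∀ A, (∀ Γ, Hilbert Γ A) → P A)
    (detach : ∀ A B, P (A.impl B) → P A → P B) {A : Formula} (h : Hilbert Δ A) : P A := by
  induction h with
  | hyp h => exact mem _ h
  | ax1 => exact valid _ fun _ => ax1 _ _
  | ax2 => exact valid _ fun _ => ax2 _ _ _
  | ax_and_intro => exact valid _ fun _ => ax_and_intro _ _
  | ax_and_left => exact valid _ fun _ => ax_and_left _ _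
  | ax_and_right => exact valid _ fun _ => ax_and_right _ _
  | ax_or_inl => exact valid _ fun _ => ax_or_inl _ _
  | ax_or_inr => exact valid _ fun _ => ax_or_inr _ _
  | ax_or_elim => exact valid _ fun _ => ax_or_elim _ _ _
  | ax_bot => exact valid _ fun _ => ax_bot _
  | ax_top => exact valid _ fun _ => ax_top
  | ax_K => exact valid _ fun _ => ax_K _ _
  | ax_coreflection => exact valid _ fun _ => ax_coreflection _
  | mp _ _ ih₁ ih₂ => exact detach _ _ ih₁ ih₂

theorem mono {Γ Δ : Set Formula} {A : Formula} (hΓ : Γ ⊆ Δ) (h : Hilbert Γ A) :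
    Hilbert Δ A :=
  axiomatic_induction (fun _ hA => hyp (hΓ hA)) (fun _ hA => hA Δ) (fun _ _ => mp) h

theorem impl_const {Γ : Set Formula} (A : Formula) {B : Formula} (h : Hilbert Γ B) :
    Hilbert Γ (A.impl B) :=
  mp (ax1 B A) h

theorem impl_self {Γ : Set Formula} (A : Formula) : Hilbert Γ (A.impl A) :=
  mp (mp (ax2 A (A.impl A) A) (ax1 A (A.impl A))) (ax1 A A)

/-- The deduction theorem. -/
theorem deduction {Γ : Set Formula} {A B : Formula} (h : Hilbert (insert A Γ) B) :
    Hilbert Γ (A.impl B) := by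
  refine axiomatic_induction (P := fun B => Hilbert Γ (A.impl B)) ?_
    (fun _ hB => impl_const A (hB Γ)) (fun _ _ h₁ h₂ => mp (mp (ax2 _ _ _) h₁) h₂) h
  rintro B (rfl | hB)
  · exact impl_self B
  · exact impl_const A (hyp hB)

theorem box {Γ : Set Formula} {A : Formula} (h : Hilbert Γ A) : Hilbert Γ A.box :=
  mp (ax_coreflection A) h

/-- If `Γ` proves `□C` for each hypothesis `C` in `Δ`, it proves `□B` for each consequence `B`
of `Δ`. -/
theorem box_of_forall_box {Γ Δ : Set Formula} {B : Formula}
    (hΔ : ∀ C ∈ Δ, Hilbert Γ C.box) (h : Hilbert Δ B) : Hilbert Γ B.box :=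
  axiomatic_induction (P := fun B => Hilbert Γ B.box) hΔ (fun _ hB => box (hB Γ))
    (fun _ _ h₁ h₂ => mp (mp (ax_K _ _) h₁) h₂) h

end Hilbert

/-- every natural deduction derivation in IEL⁻ yields a Hilbert
derivation in 𝔽IEL⁻. -/
theorem nd_to_hilbert (Γ : Set Formula) (A : Formula) (h : ND Γ A) :
    Hilbert Γ A := by
  induction h with
  | hyp h => exact .hyp h
  | top_intro => exact .ax_top
  | bot_elim _ ih => exact .mp (.ax_bot _) ih
  | and_intro _ _ ih₁ ih₂ => exact .mp (.mp (.ax_and_intro _ _) ih₁) ih₂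
  | and_elim_left _ ih => exact .mp (.ax_and_left _ _) ih
  | and_elim_right _ ih => exact .mp (.ax_and_right _ _) ih
  | impl_intro _ ih => exact ih.deduction
  | impl_elim _ _ ih₁ ih₂ => exact .mp ih₁ ih₂
  | or_intro_left _ ih => exact .mp (.ax_or_inl _ _) ih
  | or_intro_right _ ih => exact .mp (.ax_or_inr _ _) ih
  | or_elim _ _ _ ih ih₁ ih₂ =>
    exact .mp (.mp (.mp (.ax_or_elim _ _ _) ih₁.deduction) ih₂.deduction) ih
  | box_intro _ _ ih₁ ih₂ =>
    refine Hilbert.box_of_forall_box ?_ ih₂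
    rintro C (⟨p, hp, rfl⟩ | hC)
    · exact (ih₁ p hp).mono fun D hD => Or.inl (Set.mem_iUnion₂.2 ⟨p, hp, hD⟩)
    · exact Hilbert.box (.hyp (Or.inr hC))
end

section
/- If Γ ⊢_𝔽 A is derivable in the Hilbert-style system 𝔽IEL⁻, then Γ ⊢ A is derivable in the natural deduction system IEL⁻; in particular both the K-scheme □(A→B) → (□A → □B) and the co-reflection scheme A → □A are derivable in IEL⁻ with no open hypotheses. -/
namespace ND

/-- Co-reflection as a rule. -/
theorem box_of {Γ : Set Formula} {A : Formula} (h : ND Γ A) : ND Γ A.box := by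
  have := box_intro (ps := []) (Δ := Γ) (B := A) (by simp) (by simpa using h)
  simpa using this

/-- Distribution of the box over implication as a rule. -/
theorem box_mp {Γ : Set Formula} {A B : Formula} (h : ND Γ (A.impl B).box) (h' : ND Γ A.box) :
    ND Γ B.box := by
  have := box_intro (ps := [(Γ, A.impl B), (Γ, A)]) (Δ := ∅) (B := B)
    (by simp [h, h'])
    (impl_elim (A := A) (hyp (by simp)) (hyp (by simp)))
  simpa using this

theorem coreflection (Γ : Set Formula) (A : Formula) : ND Γ (A.impl A.box) :=
  impl_intro (box_of (hyp (by simp)))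

theorem box_distrib (Γ : Set Formula) (A B : Formula) :
    ND Γ ((A.impl B).box.impl (A.box.impl B.box)) :=
  impl_intro (impl_intro (box_mp (A := A) (hyp (by simp)) (hyp (by simp))))

end ND

/-- Every Hilbert derivation is simulated by a natural deduction derivation. -/
theorem Hilbert.toND {Γ : Set Formula} {A : Formula} (h : Hilbert Γ A) : ND Γ A := by
  induction h with
  | hyp h => exact .hyp h
  | ax1 A B => exact .impl_intro (.impl_intro (.hyp (by simp)))
  | ax2 A B C =>
    exact .impl_intro (.impl_intro (.impl_intro (.impl_elim (A := B)
      (.impl_elim (A := A) (.hyp (by simp)) (.hyp (by simp)))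
      (.impl_elim (A := A) (.hyp (by simp)) (.hyp (by simp))))))
  | ax_and_intro A B =>
    exact .impl_intro (.impl_intro (.and_intro (.hyp (by simp)) (.hyp (by simp))))
  | ax_and_left A B => exact .impl_intro (.and_elim_left (B := B) (.hyp (by simp)))
  | ax_and_right A B => exact .impl_intro (.and_elim_right (A := A) (.hyp (by simp)))
  | ax_or_inl A B => exact .impl_intro (.or_intro_left (.hyp (by simp)))
  | ax_or_inr A B => exact .impl_intro (.or_intro_right (.hyp (by simp)))
  | ax_or_elim A B C =>
    exact .impl_intro (.impl_intro (.impl_intro (.or_elim (A := A) (B := B) (.hyp (by simp))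
      (.impl_elim (A := A) (.hyp (by simp)) (.hyp (by simp)))
      (.impl_elim (A := B) (.hyp (by simp)) (.hyp (by simp))))))
  | ax_bot A => exact .impl_intro (.bot_elim (.hyp (by simp)))
  | ax_top => exact .top_intro
  | ax_K A B => exact ND.box_distrib _ A B
  | ax_coreflection A => exact ND.coreflection _ A
  | mp _ _ ih ih' => exact .impl_elim ih ih'

/-- every Hilbert derivation in 𝔽IEL⁻ yields a natural deduction
derivation in IEL⁻; in particular the K-scheme and co-reflection are derivable
in IEL⁻ with no open hypotheses. -/
theorem hilbert_to_nd :
    (∀ (Γ : Set Formula) (A : Formula), Hilbert Γ A → ND Γ A) ∧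
    (∀ A B : Formula,
      ND ∅ ((Formula.box (A.impl B)).impl ((Formula.box A).impl (Formula.box B)))) ∧
    (∀ A : Formula, ND ∅ (A.impl (Formula.box A))) := by
  exact ⟨fun _ _ h => h.toND, ND.box_distrib ∅, ND.coreflection ∅⟩
end

section
/- Canonicity: if a formula A has a normal deduction in IEL⁻ with no open hypotheses, then the last rule of that deduction is the introduction rule for the principal connective of A (equivalently, the corresponding closed normal proof term is a canonical form: a λ-abstraction for →, a pair for ∧, an injection for ∨, the unit term for ⊤, or a box term for □). -/
/-- Types of the modal λ-calculus. -/
inductive Ty : Type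
  | unit : Ty
  | empty : Ty
  | atom : ℕ → Ty
  | arrow : Ty → Ty → Ty
  | prod : Ty → Ty → Ty
  | sum : Ty → Ty → Ty
  | box : Ty → Ty
  deriving DecidableEq

/-- Terms of the modal λ-calculus (named variables). -/
inductive Tm : Type
  | var : ℕ → Tm
  | lam : ℕ → Tm → Tm
  | app : Tm → Tm → Tm
  | pair : Tm → Tm → Tm
  | fst : Tm → Tm
  | snd : Tm → Tm
  | inl : Tm → Tm
  | inr : Tm → Tm
  | case : Tm → ℕ → Tm → ℕ → Tm → Tm
  | abort : Tm → Tm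
  | unit : Tm
  | box : List (ℕ × Tm) → Tm → Tm

namespace Tm

/-- Substitution `t[u/x]` (naive, variable-name based). -/
def subst (x : ℕ) (u : Tm) : Tm → Tm
  | .var y => if y = x then u else .var y
  | .lam y t => if y = x then .lam y t else .lam y (subst x u t)
  | .app t s => .app (subst x u t) (subst x u s)
  | .pair t s => .pair (subst x u t) (subst x u s)
  | .fst t => .fst (subst x u t)
  | .snd t => .snd (subst x u t)
  | .inl t => .inl (subst x u t)
  | .inr t => .inr (subst x u t)
  | .case t y u₁ z u₂ =>
      .case (subst x u t) y (if y = x then u₁ else subst x u u₁)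
        z (if z = x then u₂ else subst x u u₂)
  | .abort t => .abort (subst x u t)
  | .unit => .unit
  | .box ps s =>
      .box (ps.attach.map (fun p => (p.1.1, subst x u p.1.2)))
        (if x ∈ ps.map Prod.fst then s else subst x u s)
decreasing_by
  all_goals simp_wf
  all_goals try omega
  · obtain ⟨⟨a, b⟩, hp⟩ := p
    have h1 := List.sizeOf_lt_of_mem hp
    simp at h1 ⊢
    omega

/-- `freeIn x t` : the variable `x` occurs free in `t`. -/
def freeIn (x : ℕ) : Tm → Prop
  | .var y => y = x
  | .lam y t => y ≠ x ∧ freeIn x t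
  | .app t s => freeIn x t ∨ freeIn x s
  | .pair t s => freeIn x t ∨ freeIn x s
  | .fst t => freeIn x t
  | .snd t => freeIn x t
  | .inl t => freeIn x t
  | .inr t => freeIn x t
  | .case t y u z v => freeIn x t ∨ (y ≠ x ∧ freeIn x u) ∨ (z ≠ x ∧ freeIn x v)
  | .abort t => freeIn x t
  | .unit => False
  | .box ps s =>
      (∃ p : {a // a ∈ ps}, freeIn x p.1.2) ∨ (x ∉ ps.map Prod.fst ∧ freeIn x s)
decreasing_by
  all_goals simp_wf
  all_goals try omega
  · obtain ⟨⟨a, b⟩, hp⟩ := p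
    have h1 := List.sizeOf_lt_of_mem hp
    simp at h1 ⊢
    omega

end Tm

/-- One-step reduction `t ▷ t'`: βη-reductions, permutative (commuting)
conversions, the modal reductions (ι) and (δ), and compatible (congruence) closure. -/
inductive Step : Tm → Tm → Prop
  -- β-reductions
  | beta_arrow {x t u} : Step (.app (.lam x t) u) (t.subst x u)
  | beta_fst {t s} : Step (.fst (.pair t s)) t
  | beta_snd {t s} : Step (.snd (.pair t s)) s
  | beta_inl {t x u y v} : Step (.case (.inl t) x u y v) (u.subst x t)
  | beta_inr {t x u y v} : Step (.case (.inr t) x u y v) (v.subst y t)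
  -- η-reductions
  | eta_arrow {x t} : ¬ t.freeIn x → Step (.lam x (.app t (.var x))) t
  | eta_prod {t} : Step (.pair (.fst t) (.snd t)) t
  | eta_sum {t x y} : Step (.case t x (.inl (.var x)) y (.inr (.var y))) t
  -- permutative conversions for ∨-elimination
  | perm_app_case {t x u y v w} :
      Step (.app (.case t x u y v) w) (.case t x (.app u w) y (.app v w))
  | perm_fst_case {t x u y v} :
      Step (.fst (.case t x u y v)) (.case t x (.fst u) y (.fst v))
  | perm_snd_case {t x u y v} :
      Step (.snd (.case t x u y v)) (.case t x (.snd u) y (.snd v))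
  | perm_case_case {t x u y v z w₁ z' w₂} :
      Step (.case (.case t x u y v) z w₁ z' w₂)
        (.case t x (.case u z w₁ z' w₂) y (.case v z w₁ z' w₂))
  | perm_abort_case {t x u y v} :
      Step (.abort (.case t x u y v)) (.case t x (.abort u) y (.abort v))
  -- permutative conversions for ⊥-elimination
  | perm_app_abort {t w} : Step (.app (.abort t) w) (.abort t)
  | perm_fst_abort {t} : Step (.fst (.abort t)) (.abort t)
  | perm_snd_abort {t} : Step (.snd (.abort t)) (.abort t)
  | perm_case_abort {t x u y v} : Step (.case (.abort t) x u y v) (.abort t)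
  | perm_abort_abort {t} : Step (.abort (.abort t)) (.abort t)
  -- modal reductions
  | iota {x t} : Step (.box [(x, t)] (.var x)) t
  | delta {ps₁ ps₂ : List (ℕ × Tm)} {x qs u r} :
      Step (.box (ps₁ ++ (x, .box qs u) :: ps₂) r)
        (.box (ps₁ ++ qs ++ ps₂) (r.subst x u))
  -- compatible (congruence) closure
  | congr_lam {x t t'} : Step t t' → Step (.lam x t) (.lam x t')
  | congr_app_left {t t' s} : Step t t' → Step (.app t s) (.app t' s)
  | congr_app_right {t s s'} : Step s s' → Step (.app t s) (.app t s')
  | congr_pair_left {t t' s} : Step t t' → Step (.pair t s) (.pair t' s)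
  | congr_pair_right {t s s'} : Step s s' → Step (.pair t s) (.pair t s')
  | congr_fst {t t'} : Step t t' → Step (.fst t) (.fst t')
  | congr_snd {t t'} : Step t t' → Step (.snd t) (.snd t')
  | congr_inl {t t'} : Step t t' → Step (.inl t) (.inl t')
  | congr_inr {t t'} : Step t t' → Step (.inr t) (.inr t')
  | congr_case_scrut {t t' x u y v} :
      Step t t' → Step (.case t x u y v) (.case t' x u y v)
  | congr_case_left {t x u u' y v} :
      Step u u' → Step (.case t x u y v) (.case t x u' y v)
  | congr_case_right {t x u y v v'} :
      Step v v' → Step (.case t x u y v) (.case t x u y v')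
  | congr_abort {t t'} : Step t t' → Step (.abort t) (.abort t')
  | congr_box_body {ps s s'} : Step s s' → Step (.box ps s) (.box ps s')
  | congr_box_arg {ps₁ ps₂ : List (ℕ × Tm)} {x t t' s} :
      Step t t' → Step (.box (ps₁ ++ (x, t) :: ps₂) s) (.box (ps₁ ++ (x, t') :: ps₂) s)

/-- Typing contexts: association lists of (variable, type). -/
abbrev Ctx : Type := List (ℕ × Ty)

/-- Typing judgement for the modal λ-calculus of IEL⁻-deductions. -/
inductive Typed : Ctx → Tm → Ty → Prop
  | var {Γ x A} : List.lookup x Γ = some A → Typed Γ (.var x) A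
  | lam {Γ x A t B} : Typed ((x, A) :: Γ) t B → Typed Γ (.lam x t) (.arrow A B)
  | app {Γ t s A B} : Typed Γ t (.arrow A B) → Typed Γ s A → Typed Γ (.app t s) B
  | pair {Γ t s A B} : Typed Γ t A → Typed Γ s B → Typed Γ (.pair t s) (.prod A B)
  | fst {Γ t A B} : Typed Γ t (.prod A B) → Typed Γ (.fst t) A
  | snd {Γ t A B} : Typed Γ t (.prod A B) → Typed Γ (.snd t) B
  | inl {Γ t A B} : Typed Γ t A → Typed Γ (.inl t) (.sum A B)
  | inr {Γ t A B} : Typed Γ t B → Typed Γ (.inr t) (.sum A B)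
  | case {Γ t x u y v A B D} :
      Typed Γ t (.sum A B) → Typed ((x, A) :: Γ) u D → Typed ((y, B) :: Γ) v D →
      Typed Γ (.case t x u y v) D
  | abort {Γ t A} : Typed Γ t .empty → Typed Γ (.abort t) A
  | unit {Γ} : Typed Γ .unit .unit
  | box {Γ : Ctx} {ps : List (ℕ × Tm)} {As : List Ty} {s B} :
      ps.length = As.length →
      (∀ pA ∈ ps.zip As, Typed Γ pA.1.2 (Ty.box pA.2)) →
      Typed (((ps.map Prod.fst).zip As) ++ Γ) s B →
      Typed Γ (.box ps s) (Ty.box B)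

/-- The shape of the terms of type `A` that end with an introduction rule. -/
def Tm.IsCanonical (t : Tm) : Ty → Prop
  | .unit => t = .unit
  | .empty => False
  | .atom _ => False
  | .arrow _ _ => ∃ x b, t = .lam x b
  | .prod _ _ => ∃ a b, t = .pair a b
  | .sum _ _ => (∃ a, t = .inl a) ∨ ∃ a, t = .inr a
  | .box _ => ∃ ps s, t = .box ps s

theorem Typed.isCanonical {Γ : Ctx} {t : Tm} {A : Ty} (ht : Typed Γ t A) (hΓ : Γ = [])
    (hnorm : ∀ u, ¬ Step t u) : t.IsCanonical A := by
  induction ht with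
  | var h => simp [hΓ] at h
  | lam => exact ⟨_, _, rfl⟩
  | app _ _ ih =>
    obtain ⟨x, b, rfl⟩ := ih hΓ fun _ h => hnorm _ (.congr_app_left h)
    exact (hnorm _ .beta_arrow).elim
  | pair => exact ⟨_, _, rfl⟩
  | fst _ ih =>
    obtain ⟨a, b, rfl⟩ := ih hΓ fun _ h => hnorm _ (.congr_fst h)
    exact (hnorm _ .beta_fst).elim
  | snd _ ih =>
    obtain ⟨a, b, rfl⟩ := ih hΓ fun _ h => hnorm _ (.congr_snd h)
    exact (hnorm _ .beta_snd).elim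
  | inl => exact .inl ⟨_, rfl⟩
  | inr => exact .inr ⟨_, rfl⟩
  | case _ _ _ ih =>
    obtain ⟨a, rfl⟩ | ⟨a, rfl⟩ := ih hΓ fun _ h => hnorm _ (.congr_case_scrut h)
    · exact (hnorm _ .beta_inl).elim
    · exact (hnorm _ .beta_inr).elim
  | abort _ ih => exact (ih hΓ fun _ h => hnorm _ (.congr_abort h)).elim
  | unit => rfl
  | box => exact ⟨_, _, rfl⟩

/-- canonicity: a closed normal proof term is a canonical form,
i.e., the last rule is the introduction rule for the principal connective:
a λ-abstraction for →, a pair for ∧, an injection for ∨, the unit term for ⊤,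
and a box term for □. -/
theorem canonicity {t : Tm} {A : Ty} (ht : Typed [] t A)
    (hnorm : ∀ u : Tm, ¬ Step t u) :
    (∀ B D : Ty, A = Ty.arrow B D → ∃ (x : ℕ) (b : Tm), t = Tm.lam x b) ∧
    (∀ B D : Ty, A = Ty.prod B D → ∃ a b : Tm, t = Tm.pair a b) ∧
    (∀ B D : Ty, A = Ty.sum B D → (∃ a : Tm, t = Tm.inl a) ∨ (∃ a : Tm, t = Tm.inr a)) ∧
    (A = Ty.unit → t = Tm.unit) ∧
    (∀ B : Ty, A = Ty.box B → ∃ (ps : List (ℕ × Tm)) (s : Tm), t = Tm.box ps s) := by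
  have hc := ht.isCanonical rfl hnorm
  refine ⟨?_, ?_, ?_, ?_, ?_⟩
  · rintro B D rfl
    exact hc
  · rintro B D rfl
    exact hc
  · rintro B D rfl
    exact hc
  · rintro rfl
    exact hc
  · rintro B rfl
    exact hc
end

section
/- Disjunction property: if A ∨ B is derivable in the natural deduction system IEL⁻ with no open hypotheses, then A is derivable with no open hypotheses or B is derivable with no open hypotheses. -/
namespace ND

/-- A form of `box_intro` in which all premises share one context. -/
theorem box_intro_of_forall {Γ : Set Formula} {B : Formula} (ps : List (Set Formula × Formula))
    (hps : ∀ p ∈ ps, ND Γ p.2.box) (hB : ND ({A | ∃ p ∈ ps, p.2 = A} ∪ Γ) B) :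
    ND Γ B.box := by
  have h := box_intro (ps := ps.map fun p => (Γ, p.2)) (Δ := Γ) (B := B)
    (List.forall_mem_map.2 hps) (by simpa using hB)
  rwa [Set.union_eq_self_of_subset_left] at h
  exact Set.iUnion₂_subset (List.forall_mem_map.2 fun _ _ => subset_rfl)

/-- Weakening. -/
theorem mono {Γ Γ' : Set Formula} {A : Formula} (h : ND Γ A) (hΓ : Γ ⊆ Γ') : ND Γ' A := by
  induction h generalizing Γ' with
  | hyp h => exact hyp (hΓ h)
  | top_intro => exact top_intro
  | bot_elim _ ih => exact bot_elim (ih hΓ)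
  | and_intro _ _ ih₁ ih₂ => exact and_intro (ih₁ hΓ) (ih₂ hΓ)
  | and_elim_left _ ih => exact and_elim_left (ih hΓ)
  | and_elim_right _ ih => exact and_elim_right (ih hΓ)
  | impl_intro _ ih => exact impl_intro (ih (Set.insert_subset_insert hΓ))
  | impl_elim _ _ ih₁ ih₂ => exact impl_elim (ih₁ hΓ) (ih₂ hΓ)
  | or_intro_left _ ih => exact or_intro_left (ih hΓ)
  | or_intro_right _ ih => exact or_intro_right (ih hΓ)
  | or_elim _ _ _ ih ih₁ ih₂ =>
    exact or_elim (ih hΓ) (ih₁ (Set.insert_subset_insert hΓ)) (ih₂ (Set.insert_subset_insert hΓ))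
  | @box_intro ps Δ B _ _ ihps ihB =>
    obtain ⟨hps, hΔ⟩ := Set.union_subset_iff.1 hΓ
    exact box_intro_of_forall ps
      (fun p hp => ihps p hp (Set.iUnion₂_subset_iff.1 hps p hp))
      (ihB (Set.union_subset_union_right _ hΔ))

theorem forall_mem_insert {Γ Γ' : Set Formula} (h : ∀ A ∈ Γ, ND Γ' A) (B : Formula) :
    ∀ A ∈ insert B Γ, ND (insert B Γ') A := by
  rintro A (rfl | hA)
  · exact hyp (Set.mem_insert _ _)
  · exact (h A hA).mono (Set.subset_insert _ _)

/-- Simultaneous substitution of derivations for hypotheses. -/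
theorem subst {Γ Γ' : Set Formula} {A : Formula} (h : ND Γ A) (hΓ : ∀ B ∈ Γ, ND Γ' B) :
    ND Γ' A := by
  induction h generalizing Γ' with
  | hyp h => exact hΓ _ h
  | top_intro => exact top_intro
  | bot_elim _ ih => exact bot_elim (ih hΓ)
  | and_intro _ _ ih₁ ih₂ => exact and_intro (ih₁ hΓ) (ih₂ hΓ)
  | and_elim_left _ ih => exact and_elim_left (ih hΓ)
  | and_elim_right _ ih => exact and_elim_right (ih hΓ)
  | impl_intro _ ih => exact impl_intro (ih (forall_mem_insert hΓ _))
  | impl_elim _ _ ih₁ ih₂ => exact impl_elim (ih₁ hΓ) (ih₂ hΓ)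
  | or_intro_left _ ih => exact or_intro_left (ih hΓ)
  | or_intro_right _ ih => exact or_intro_right (ih hΓ)
  | or_elim _ _ _ ih ih₁ ih₂ =>
    exact or_elim (ih hΓ) (ih₁ (forall_mem_insert hΓ _)) (ih₂ (forall_mem_insert hΓ _))
  | @box_intro ps Δ B _ _ ihps ihB =>
    refine box_intro_of_forall ps
      (fun p hp => ihps p hp fun C hC => hΓ C (.inl (Set.mem_biUnion hp hC))) (ihB ?_)
    rintro C (hC | hC)
    · exact hyp (.inl hC)
    · exact (hΓ C (.inr hC)).mono Set.subset_union_right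

end ND

namespace Formula

/-- The Aczel slash relative to the empty context, with `□A` slashed exactly when `A` is. -/
def Slash : Formula → Prop
  | atom _ => False
  | bot => False
  | top => True
  | and A B => A.Slash ∧ B.Slash
  | or A B => A.Slash ∨ B.Slash
  | impl A B => ND ∅ (A.impl B) ∧ (A.Slash → B.Slash)
  | box A => A.Slash

theorem Slash.derivable {A : Formula} (h : A.Slash) : ND ∅ A := by
  induction A with
  | atom _ => exact h.elim
  | bot => exact h.elim
  | top => exact .top_intro
  | and A B ihA ihB => exact .and_intro (ihA h.1) (ihB h.2)
  | or A B ihA ihB => exact h.elim (fun h => .or_intro_left (ihA h)) fun h => .or_intro_right (ihB h)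
  | impl A B _ _ => exact h.1
  | box A ih => exact ND.box_intro_of_forall [] (by simp) ((ih h).mono (Set.empty_subset _))

end Formula

/-- Derivations from slashed hypotheses have slashed conclusions. -/
theorem ND.slash {Γ : Set Formula} {A : Formula} (h : ND Γ A) (hΓ : ∀ B ∈ Γ, B.Slash) :
    A.Slash := by
  induction h with
  | hyp h => exact hΓ _ h
  | top_intro => exact trivial
  | bot_elim _ ih => exact (ih hΓ).elim
  | and_intro _ _ ih₁ ih₂ => exact ⟨ih₁ hΓ, ih₂ hΓ⟩
  | and_elim_left _ ih => exact (ih hΓ).1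
  | and_elim_right _ ih => exact (ih hΓ).2
  | impl_intro h ih =>
    exact ⟨(ND.impl_intro h).subst fun B hB => (hΓ B hB).derivable,
      fun hA => ih (Set.forall_mem_insert.2 ⟨hA, hΓ⟩)⟩
  | impl_elim _ _ ih₁ ih₂ => exact (ih₁ hΓ).2 (ih₂ hΓ)
  | or_intro_left _ ih => exact .inl (ih hΓ)
  | or_intro_right _ ih => exact .inr (ih hΓ)
  | or_elim _ _ _ ih ih₁ ih₂ =>
    exact (ih hΓ).elim (fun hA => ih₁ (Set.forall_mem_insert.2 ⟨hA, hΓ⟩))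
      fun hB => ih₂ (Set.forall_mem_insert.2 ⟨hB, hΓ⟩)
  | box_intro _ _ ihps ihB =>
    refine ihB ?_
    rintro C (⟨p, hp, rfl⟩ | hC)
    · exact ihps p hp fun D hD => hΓ D (.inl (Set.mem_biUnion hp hD))
    · exact hΓ C (.inr hC)

/-- the disjunction property of IEL⁻. -/
theorem disjunction_property (A B : Formula) (h : ND ∅ (A.or B)) :
    ND ∅ A ∨ ND ∅ B := by
  exact (h.slash (by simp)).imp Formula.Slash.derivable Formula.Slash.derivable
end

section
/- Consistency of IEL⁻: the formula ⊥ is not derivable in the natural deduction system IEL⁻ with no open hypotheses. -/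
/-- Classical truth under a valuation of the atoms, reading every boxed formula as true. -/
def Formula.Holds (v : ℕ → Prop) : Formula → Prop
  | .atom n => v n
  | .bot => False
  | .top => True
  | .and A B => A.Holds v ∧ B.Holds v
  | .or A B => A.Holds v ∨ B.Holds v
  | .impl A B => A.Holds v → B.Holds v
  | .box _ => True

theorem ND.sound (v : ℕ → Prop) {Γ : Set Formula} {A : Formula} (h : ND Γ A)
    (hΓ : ∀ B ∈ Γ, B.Holds v) : A.Holds v := by
  induction h with
  | hyp hA => exact hΓ _ hA
  | top_intro => trivial
  | bot_elim _ ih => exact (ih hΓ).elim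
  | and_intro _ _ ihA ihB => exact ⟨ihA hΓ, ihB hΓ⟩
  | and_elim_left _ ih => exact (ih hΓ).1
  | and_elim_right _ ih => exact (ih hΓ).2
  | impl_intro _ ih => exact fun hA => ih (Set.forall_mem_insert.2 ⟨hA, hΓ⟩)
  | impl_elim _ _ ihAB ihA => exact ihAB hΓ (ihA hΓ)
  | or_intro_left _ ih => exact Or.inl (ih hΓ)
  | or_intro_right _ ih => exact Or.inr (ih hΓ)
  | or_elim _ _ _ ih ihA ihB =>
    exact (ih hΓ).elim (fun hA => ihA (Set.forall_mem_insert.2 ⟨hA, hΓ⟩))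
      (fun hB => ihB (Set.forall_mem_insert.2 ⟨hB, hΓ⟩))
  | box_intro => trivial

/-- consistency of IEL⁻: ⊥ is not derivable with no open
hypotheses. -/
theorem consistency : ¬ ND ∅ Formula.bot :=
  fun h => h.sound (fun _ => False) (by simp)
end
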